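/- arXiv:0801.2179 — 3 statements merged into one kernel-verified Lean document; each statement's English description precedes it below -/
import Mathlib

section
/- For every finite nonempty set A there is a constant C_A > 0 (depending only on |A|) such that for every σ ∈ (0,1) there exists M₀ (depending on A and σ) with the following property: for every M ≥ M₀, with probability at least 1 − C_A·σ over the random corrupted directed graph G on [M], for every injection φ: A → [M] there exists at least one pair of distinct vertices v₁,v₂ ∈ [M]∖φ(A) that are indistinguishable relative to φ. -/
/-! Statement 11: a corrupted random total ordering on `[M]` contains, with probability
`1 - O_A(σ)`, an indistinguishable pair of vertices outside `φ(A)`, for every injection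
`φ : A → [M]` simultaneously. -/

/-- The sample space for the corrupted directed graph on `[M]`: a Boolean value for each
ordered pair of distinct vertices, recording whether `v <_G w` holds. -/
abbrev DigraphSpace (M : ℕ) : Type := {p : Fin M × Fin M // p.1 ≠ p.2} → Bool

/-- The probability weight of an outcome `g`: independently for each ordered pair `(v,w)` of
distinct vertices, the statement `v <_G w` has the same truth value as `v < w` with
probability `1 - σ` and the opposite truth value with probability `σ`. -/
noncomputable def digraphWeight (M : ℕ) (σ : ℝ) (g : DigraphSpace M) : ℝ :=
  ∏ p : {p : Fin M × Fin M // p.1 ≠ p.2},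
    if g p = decide (p.1.1 < p.1.2) then 1 - σ else σ

open scoped Classical in
/-- The probability of an event `E` in a finite weighted sample space. -/
noncomputable def probOf {Ω : Type} [Fintype Ω] (w : Ω → ℝ) (E : Set Ω) : ℝ :=
  ∑ g : Ω, if g ∈ E then w g else 0

/-- The relation `v <_G w` determined by an outcome `g` (for distinct `v, w`). -/
def digraphLT {M : ℕ} (g : DigraphSpace M) (v w : Fin M) : Prop :=
  ∃ h : v ≠ w, g ⟨(v, w), h⟩ = true

/-- Two distinct vertices `v₁, v₂ ∉ φ(A)` are indistinguishable relative to `φ`: they relate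
in the same way to every training vertex `φ(a)`, and `v₁ <_G v₂` and `v₂ <_G v₁` have the
same truth value. -/
def Indistinguishable {M a : ℕ} (g : DigraphSpace M) (φ : Fin a ↪ Fin M)
    (v₁ v₂ : Fin M) : Prop :=
  v₁ ≠ v₂ ∧ v₁ ∉ Set.range φ ∧ v₂ ∉ Set.range φ ∧
    (∀ i : Fin a, (digraphLT g v₁ (φ i) ↔ digraphLT g v₂ (φ i)) ∧
      (digraphLT g (φ i) v₁ ↔ digraphLT g (φ i) v₂)) ∧
    (digraphLT g v₁ v₂ ↔ digraphLT g v₂ v₁)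

/-- Increasing pairs of vertices, representing unordered pairs. -/
abbrev IncreasingPair (M : ℕ) : Type := {p : Fin M × Fin M // p.1 < p.2}

/-- The ordered pair of distinct vertices obtained by orienting an increasing pair. -/
def orient {M : ℕ} (x : IncreasingPair M × Bool) : {p : Fin M × Fin M // p.1 ≠ p.2} :=
  if x.2 then ⟨x.1.1, x.1.2.ne⟩ else ⟨x.1.1.swap, x.1.2.ne'⟩

theorem orient_bijective (M : ℕ) : Function.Bijective (orient (M := M)) := by
  constructor
  · rintro ⟨⟨⟨v, w⟩, h⟩, b⟩ ⟨⟨⟨v', w'⟩, h'⟩, b'⟩ heq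
    cases b <;> cases b' <;> simp [orient] at heq h h' ⊢ <;> omega
  · rintro ⟨⟨v, w⟩, h⟩
    rcases lt_or_gt_of_ne h with h' | h'
    · exact ⟨(⟨(v, w), h'⟩, true), rfl⟩
    · exact ⟨(⟨(w, v), h'⟩, false), rfl⟩

/-- Outcomes, regrouped by unordered pairs of vertices. -/
noncomputable def pairOutcomeEquiv (M : ℕ) :
    DigraphSpace M ≃ (IncreasingPair M → Bool → Bool) :=
  ((Equiv.ofBijective _ (orient_bijective M)).arrowCongr (Equiv.refl Bool)).symm.trans
    (Equiv.curry _ _ _)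

theorem pairOutcomeEquiv_apply {M : ℕ} (g : DigraphSpace M) (p : IncreasingPair M) (b : Bool) :
    pairOutcomeEquiv M g p b = g (orient (p, b)) := rfl

/-- The restriction of `g` to `S` is a tournament. -/
def IsTournamentOn {M : ℕ} (g : DigraphSpace M) (S : Finset (Fin M)) : Prop :=
  ∀ p : IncreasingPair M, p.1.1 ∈ S ∧ p.1.2 ∈ S → g (orient (p, true)) ≠ g (orient (p, false))

/-- The increasing pairs with both endpoints in `S`. -/
def increasingPairsIn {M : ℕ} (S : Finset (Fin M)) : Finset (IncreasingPair M) :=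
  {p | p.1.1 ∈ S ∧ p.1.2 ∈ S}

theorem digraphWeight_eq_prod {M : ℕ} (σ : ℝ) (g : DigraphSpace M) :
    digraphWeight M σ g = ∏ p : IncreasingPair M,
      (if g (orient (p, true)) then 1 - σ else σ) *
        (if g (orient (p, false)) then σ else 1 - σ) := by
  rw [digraphWeight, ← (Equiv.ofBijective _ (orient_bijective M)).prod_comp,
    Fintype.prod_prod_type]
  refine Finset.prod_congr rfl fun p _ => ?_
  have hlt : decide ((orient (p, true)).1.1 < (orient (p, true)).1.2) = true :=
    decide_eq_true p.2
  have hgt : decide ((orient (p, false)).1.1 < (orient (p, false)).1.2) = false :=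
    decide_eq_false (not_lt_of_gt p.2)
  rw [Fintype.prod_bool, Equiv.ofBijective_apply, Equiv.ofBijective_apply, hlt, hgt]
  cases g (orient (p, false)) <;> simp

theorem digraphWeight_nonneg {M : ℕ} {σ : ℝ} (h₀ : 0 ≤ σ) (h₁ : σ ≤ 1) (g : DigraphSpace M) :
    0 ≤ digraphWeight M σ g :=
  Finset.prod_nonneg fun _ _ => by split_ifs <;> linarith

theorem sum_bool_arrow_ite (σ : ℝ) (P : Prop) [Decidable P] :
    ∑ c : Bool → Bool, (if P → c true ≠ c false then
      (if c true then 1 - σ else σ) * (if c false then σ else 1 - σ) else 0) =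
      if P then (1 - σ) ^ 2 + σ ^ 2 else 1 := by
  rw [← (Equiv.boolArrowEquivProd Bool).symm.sum_comp, Fintype.sum_prod_type]
  by_cases h : P <;> simp [Equiv.boolArrowEquivProd, h] <;> ring

open scoped Classical in
theorem sum_digraphWeight_isTournamentOn {M : ℕ} (σ : ℝ) (S : Finset (Fin M)) :
    ∑ g : DigraphSpace M, (if IsTournamentOn g S then digraphWeight M σ g else 0) =
      ((1 - σ) ^ 2 + σ ^ 2) ^ (increasingPairsIn S).card := by
  let f (p : IncreasingPair M) (c : Bool → Bool) : ℝ :=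
    if p.1.1 ∈ S ∧ p.1.2 ∈ S → c true ≠ c false then
      (if c true then 1 - σ else σ) * (if c false then σ else 1 - σ) else 0
  have hf (g : DigraphSpace M) :
      (if IsTournamentOn g S then digraphWeight M σ g else 0) =
        ∏ p, f p (pairOutcomeEquiv M g p) := by
    simp only [f]
    rw [Fintype.prod_ite_zero, digraphWeight_eq_prod]
    exact if_congr Iff.rfl rfl rfl
  have hsum (p : IncreasingPair M) : ∑ c, f p c =
      if p.1.1 ∈ S ∧ p.1.2 ∈ S then (1 - σ) ^ 2 + σ ^ 2 else 1 :=
    sum_bool_arrow_ite σ _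
  simp_rw [hf]
  rw [(pairOutcomeEquiv M).sum_comp (fun k => ∏ p, f p (k p)), ← Fintype.prod_sum]
  simp_rw [hsum]
  rw [Finset.prod_ite]
  simp [increasingPairsIn]

theorem sum_digraphWeight (M : ℕ) (σ : ℝ) : ∑ g : DigraphSpace M, digraphWeight M σ g = 1 := by
  simpa [IsTournamentOn, increasingPairsIn] using
    sum_digraphWeight_isTournamentOn (M := M) σ ∅

theorem card_mul_pred_le_two_mul_card_increasingPairsIn {M : ℕ} (S : Finset (Fin M)) :
    S.card * S.card - S.card ≤ 2 * (increasingPairsIn S).card := by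
  rw [← Finset.offDiag_card]
  have hsub : S.offDiag ⊆
      ((increasingPairsIn S) ×ˢ (Finset.univ : Finset Bool)).image fun x => (orient x).1 := by
    rintro ⟨v, w⟩ h
    rw [Finset.mem_offDiag] at h
    rw [Finset.mem_image]
    rcases lt_or_gt_of_ne h.2.2 with h' | h'
    · exact ⟨(⟨(v, w), h'⟩, true), by simp [increasingPairsIn, h.1, h.2.1], rfl⟩
    · exact ⟨(⟨(w, v), h'⟩, false), by simp [increasingPairsIn, h.1, h.2.1], rfl⟩
  calc _ ≤ _ := Finset.card_le_card hsub
    _ ≤ _ := Finset.card_image_le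
    _ = _ := by simp [Finset.card_product, mul_comm]

open scoped Classical in
/-- The way a vertex relates to the vertices in the range of `φ`. -/
noncomputable def signature {M a : ℕ} (g : DigraphSpace M) (φ : Fin a ↪ Fin M) (v : Fin M) :
    Fin a → Bool × Bool :=
  fun i => (decide (digraphLT g v (φ i)), decide (digraphLT g (φ i) v))

theorem exists_isTournamentOn {M a n : ℕ} (g : DigraphSpace M) (φ : Fin a ↪ Fin M)
    (hn : 4 ^ a * n + a < M) (hg : ¬ ∃ v₁ v₂ : Fin M, Indistinguishable g φ v₁ v₂) :
    ∃ S : Finset (Fin M), n < S.card ∧ IsTournamentOn g S := by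
  classical
  have hcard : (Finset.univ.map φ)ᶜ.card = M - a := by simp [Finset.card_compl]
  obtain ⟨y, -, hy⟩ := Finset.exists_lt_card_fiber_of_mul_lt_card_of_maps_to
    (s := (Finset.univ.map φ)ᶜ) (t := Finset.univ) (f := signature g φ) (n := n)
    (fun _ _ => Finset.mem_univ _) (by
      rw [hcard, Finset.card_univ]
      simp only [Fintype.card_pi, Fintype.card_prod, Fintype.card_bool, Finset.prod_const,
        Finset.card_univ, Fintype.card_fin]
      norm_num
      omega)
  refine ⟨_, hy, fun p hp heq => hg ⟨p.1.1, p.1.2, p.2.ne, ?_⟩⟩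
  simp only [Finset.mem_filter, Finset.mem_compl, Finset.mem_map, Finset.mem_univ, true_and]
    at hp
  refine ⟨hp.1.1, hp.2.1, fun i => ?_, ?_⟩
  · have := congrFun (hp.1.2.trans hp.2.2.symm) i
    simpa [signature] using this
  · have h := p.2.ne
    have h' := p.2.ne'
    simp only [orient, if_true, Bool.false_eq_true, if_false] at heq
    simp only [digraphLT, h, h', ne_eq, not_false_eq_true, exists_true_left]
    exact Bool.eq_iff_iff.mp heq

theorem one_sub_le_probOf_exists_indistinguishable {M a n : ℕ} {σ : ℝ} (h₀ : 0 ≤ σ)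
    (h₁ : σ ≤ 1) (hn : 4 ^ a * n + a < M) {m : ℕ} (hm : 2 * m ≤ (n + 1) * n) :
    1 - 2 ^ M * ((1 - σ) ^ 2 + σ ^ 2) ^ m ≤ probOf (digraphWeight M σ)
      {g : DigraphSpace M | ∀ φ : Fin a ↪ Fin M,
        ∃ v₁ v₂ : Fin M, Indistinguishable g φ v₁ v₂} := by
  classical
  set E := {g : DigraphSpace M | ∀ φ : Fin a ↪ Fin M,
    ∃ v₁ v₂ : Fin M, Indistinguishable g φ v₁ v₂} with hE
  let F : Finset (Finset (Fin M)) := {S | n < S.card}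
  have hw := digraphWeight_nonneg (M := M) h₀ h₁
  have hpoint (g : DigraphSpace M) : digraphWeight M σ g ≤
      (if g ∈ E then digraphWeight M σ g else 0) +
        ∑ S ∈ F, if IsTournamentOn g S then digraphWeight M σ g else 0 := by
    have hnonneg (S : Finset (Fin M)) :
        0 ≤ if IsTournamentOn g S then digraphWeight M σ g else 0 := by
      split_ifs
      exacts [hw g, le_rfl]
    by_cases hg : g ∈ E
    · simpa [hg] using Finset.sum_nonneg fun S (_ : S ∈ F) => hnonneg S
    · obtain ⟨φ, hφ⟩ : ∃ φ : Fin a ↪ Fin M,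
          ¬ ∃ v₁ v₂ : Fin M, Indistinguishable g φ v₁ v₂ := by
        simpa only [hE, Set.mem_ofPred_eq, not_forall] using hg
      obtain ⟨S, hS, hT⟩ := exists_isTournamentOn g φ hn hφ
      have := Finset.single_le_sum (fun S (_ : S ∈ F) => hnonneg S)
        (show S ∈ F by simpa [F] using hS)
      simpa [hg, hT] using this
  have hS (S) (hSF : S ∈ F) :
      ∑ g : DigraphSpace M, (if IsTournamentOn g S then digraphWeight M σ g else 0) ≤
        ((1 - σ) ^ 2 + σ ^ 2) ^ m := by
    rw [sum_digraphWeight_isTournamentOn]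
    refine pow_le_pow_of_le_one (by positivity) (by nlinarith) ?_
    have hc : n < S.card := by simpa [F] using hSF
    have := card_mul_pred_le_two_mul_card_increasingPairsIn S
    have hmul : (n + 1) * n ≤ S.card * (S.card - 1) := Nat.mul_le_mul hc (by omega)
    rw [Nat.mul_sub_one] at hmul
    omega
  have hF : (F.card : ℝ) ≤ 2 ^ M := by
    have := Finset.card_le_univ F
    rw [Fintype.card_finset, Fintype.card_fin] at this
    exact_mod_cast this
  have htotal := Finset.sum_le_sum fun g (_ : g ∈ Finset.univ) => hpoint g
  rw [sum_digraphWeight, Finset.sum_add_distrib, Finset.sum_comm (t := F)] at htotal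
  have hunion := Finset.sum_le_card_nsmul F _ _ hS
  rw [nsmul_eq_mul] at hunion
  have := mul_le_mul_of_nonneg_right hF
    (show 0 ≤ ((1 - σ) ^ 2 + σ ^ 2) ^ m by positivity)
  have hprob : probOf (digraphWeight M σ) E =
      ∑ g, if g ∈ E then digraphWeight M σ g else 0 :=
    Finset.sum_congr rfl fun g _ => by by_cases h : g ∈ E <;> simp only [h, if_true, if_false]
  linarith

/-- For every finite nonempty set `A` (of cardinality `a > 0`) there is a
constant `C_A > 0` depending only on `|A| = a` such that for every `σ ∈ (0,1)` there exists
`M₀` with: for every `M ≥ M₀`, with probability at least `1 - C_A·σ` over the random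
corrupted directed graph on `[M]`, for every injection `φ : A → [M]` there is at least one
indistinguishable pair of distinct vertices of `[M] ∖ φ(A)`. -/
theorem indistinguishable_pair_whp (a : ℕ) (ha : 0 < a) :
    ∃ C : ℝ, 0 < C ∧
      ∀ σ : ℝ, 0 < σ → σ < 1 →
        ∃ M₀ : ℕ, ∀ M : ℕ, M₀ ≤ M →
          1 - C * σ ≤
            probOf (digraphWeight M σ)
              {g : DigraphSpace M | ∀ φ : Fin a ↪ Fin M,
                ∃ v₁ v₂ : Fin M, Indistinguishable g φ v₁ v₂} := by
  refine ⟨1, one_pos, fun σ h₀ h₁ => ?_⟩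
  set q := (1 - σ) ^ 2 + σ ^ 2 with hq
  have hq₀ : 0 ≤ q := by positivity
  have hq₁ : q < 1 := by nlinarith
  obtain ⟨T, hT⟩ := exists_pow_lt_of_lt_one (show (0 : ℝ) < 1 / 4 by norm_num) hq₁
  obtain ⟨N, hN⟩ := exists_pow_lt_of_lt_one h₀ (show (1 / 2 : ℝ) < 1 by norm_num)
  set K := 4 ^ a with hK
  have hKpos : 0 < K := by positivity
  refine ⟨2 * K * (4 * K * T) + 2 * a + N + 1, fun M hM => ?_⟩
  have hn : 4 * K * T ≤ M / (2 * K) :=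
    (Nat.le_div_iff_mul_le (by positivity)).mpr (by rw [mul_comm]; omega)
  have hlt : M < 2 * K * (M / (2 * K) + 1) := Nat.lt_mul_div_succ M (by positivity)
  have hle : 2 * K * (M / (2 * K)) ≤ M := Nat.mul_div_le M (2 * K)
  have hpairs : 2 * (T * M) ≤ (M / (2 * K) + 1) * (M / (2 * K)) := by
    calc 2 * (T * M) ≤ 2 * (T * (2 * K * (M / (2 * K) + 1))) := by gcongr
      _ = (M / (2 * K) + 1) * (4 * K * T) := by ring
      _ ≤ _ := Nat.mul_le_mul_left _ hn
  refine le_trans ?_ (one_sub_le_probOf_exists_indistinguishable h₀.le h₁.le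
    (by rw [mul_assoc] at hle; rw [← hK]; omega) hpairs)
  rw [← hq, pow_mul, ← mul_pow, one_mul]
  have hbase : (2 * q ^ T) ^ M ≤ (1 / 2) ^ M :=
    pow_le_pow_left₀ (by positivity) (by linarith) M
  have hexp : (1 / 2 : ℝ) ^ M ≤ (1 / 2) ^ N :=
    pow_le_pow_of_le_one (by norm_num) (by norm_num) (by omega)
  linarith
end

section
/- Let Z be a sub-Cantor palette of order at most k and let (X,ν) be a probability space. Suppose that to each element α of Col(Z) is assigned a measurable function F_α: X → [−1,1], and that for ν-almost every x ∈ X one has lim_{α→∞} F_α(x) = 0 (in the colouring-topology sense). Then lim_{α→∞} ∫_X F_α dν = 0. -/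
open MeasureTheory

/-- A sub-Cantor space: a topological space homeomorphic to a compact subset of the
standard Cantor space `{0,1}^ℕ`. -/
def IsSubCantor (X : Type) [TopologicalSpace X] : Prop :=
  ∃ s : Set (ℕ → Bool), IsCompact s ∧ Nonempty (X ≃ₜ s)

/-- The space `Z^(V)` of `Z`-coloured hypergraphs on a vertex set `V`, for a sub-Cantor
palette `Z`. -/
def CHyp (Z : ℕ → Type) (V : Type) : Type :=
  ∀ j : ℕ, (Fin j ↪ V) → Z j

instance (Z : ℕ → Type) [∀ j, TopologicalSpace (Z j)] (V : Type) :
    TopologicalSpace (CHyp Z V) :=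
  inferInstanceAs (TopologicalSpace (∀ j : ℕ, (Fin j ↪ V) → Z j))

instance (Z : ℕ → Type) [∀ j, TopologicalSpace (Z j)] (V : Type) :
    MeasurableSpace (CHyp Z V) := borel _

instance (Z : ℕ → Type) [∀ j, TopologicalSpace (Z j)] (V : Type) :
    BorelSpace (CHyp Z V) := ⟨rfl⟩

/-- The pullback map `Z^(φ) : Z^(V) → Z^(W)` along an injection `φ : W ↪ V`. -/
def cpullback (Z : ℕ → Type) {V W : Type} (φ : W ↪ V) (z : CHyp Z V) : CHyp Z W :=
  fun j ψ => z j (ψ.trans φ)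

/-- An exchangeable `Z`-recipe: a Borel probability measure on `Z^(V)` for every (at most
countable) vertex set `V`, compatible with all pullbacks. -/
structure ExchRecipe (Z : ℕ → Type) [∀ j, TopologicalSpace (Z j)] where
  μ : ∀ (V : Type) [Countable V], Measure (CHyp Z V)
  prob : ∀ (V : Type) [Countable V], IsProbabilityMeasure (μ V)
  exch : ∀ (V : Type) [Countable V] (W : Type) [Countable W] (φ : W ↪ V),
    (μ V).map (cpullback Z φ) = μ W

/-- A "colouring algebra" on a space: a finite σ-algebra generated by clopen sets. -/
def IsColAlg {X : Type} [TopologicalSpace X] (B : MeasurableSpace X) : Prop :=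
  {s : Set X | MeasurableSet[B] s}.Finite ∧
    ∃ C : Set (Set X), (∀ s ∈ C, IsClopen s) ∧ B = MeasurableSpace.generateFrom C

/-- The set `Col(Z)` of tuples `(B_0, …, B_k)` of colouring algebras on the components of a
palette `Z` of order at most `k`. -/
def ColTuple (Z : ℕ → Type) [∀ j, TopologicalSpace (Z j)] (k : ℕ) : Type :=
  ∀ i : Fin (k + 1), {B : MeasurableSpace (Z i.val) // IsColAlg B}

/-- The sub-basic open sets of `Col(Z)`: for `0 ≤ i ≤ k` and an arbitrary function `F` of
the components of index `> i`, the set of tuples with `B_i ⊇ F(B_{i+1}, …, B_k)`. -/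
def colSubbasis (Z : ℕ → Type) [∀ j, TopologicalSpace (Z j)] (k : ℕ) :
    Set (Set (ColTuple Z k)) :=
  {U | ∃ (i : Fin (k + 1))
      (F : (∀ i' : Fin (k + 1), i < i' → {B : MeasurableSpace (Z i'.val) // IsColAlg B}) →
        {B : MeasurableSpace (Z i.val) // IsColAlg B}),
      U = {α | (F fun i' _ => α i').val ≤ (α i).val}}

/-- The colouring topology on `Col(Z)`. -/
instance (Z : ℕ → Type) [∀ j, TopologicalSpace (Z j)] (k : ℕ) :
    TopologicalSpace (ColTuple Z k) :=
  TopologicalSpace.generateFrom (colSubbasis Z k)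

/-- `lim_{α → ∞} c(α) = 0` in the colouring-topology sense: for every `ε > 0`, the bound
`|c(α)| ≤ ε` holds for all sufficiently fine colourings `α` (i.e. on some nonempty open
subset of `Col(Z)`). -/
def TendstoFine (Z : ℕ → Type) [∀ j, TopologicalSpace (Z j)] (k : ℕ)
    (c : ColTuple Z k → ℝ) : Prop :=
  ∀ ε : ℝ, 0 < ε → ∃ U : Set (ColTuple Z k), IsOpen U ∧ U.Nonempty ∧ ∀ α ∈ U, |c α| ≤ ε

open Filter Topology
open scoped ENNReal

/-- Reverse Fatou lemma along a countably generated filter on a countable type. -/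
theorem limsup_lintegral_le_of_countable {ι X : Type*} [Countable ι] [MeasurableSpace X]
    {ν : Measure X} {l : Filter ι} [l.IsCountablyGenerated] {f : ι → X → ℝ≥0∞} (g : X → ℝ≥0∞)
    (hf : ∀ i, Measurable (f i)) (hfg : ∀ i, f i ≤ g) (hg : ∫⁻ x, g x ∂ν ≠ ∞) :
    limsup (fun i => ∫⁻ x, f i x ∂ν) l ≤ ∫⁻ x, limsup (fun i => f i x) l ∂ν := by
  obtain ⟨s, hs⟩ := l.exists_antitone_basis
  simp only [hs.toHasBasis.limsup_eq_iInf_iSup, iInf_true]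
  rw [lintegral_iInf]
  · exact iInf_mono fun n => iSup₂_lintegral_le _
  · exact fun n => .biSup _ (Set.to_countable _) fun i _ => hf i
  · exact fun m n hmn x => iSup_le_iSup_of_subset (hs.antitone hmn)
  · exact ne_top_of_le_ne_top hg (lintegral_mono fun x => iSup₂_le fun i _ => hfg i x)

theorem measurable_limsup_of_countable {ι X : Type*} [Countable ι] [MeasurableSpace X]
    {l : Filter ι} [l.IsCountablyGenerated] {f : ι → X → ℝ≥0∞} (hf : ∀ i, Measurable (f i)) :
    Measurable fun x => limsup (fun i => f i x) l := by
  obtain ⟨s, hs⟩ := l.exists_antitone_basis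
  exact .limsup' hf ⟨hs.toHasBasis, Set.to_countable _⟩ fun i => Set.to_countable _

/-- The iterated filter on a finite product of preorders: a property holds eventually if,
for all large `α (n - 1)`, for all large `α (n - 2)`, …, for all large `α 0`, it holds
at `α`. -/
def iterAtTop : ∀ {n : ℕ} (C : Fin n → Type*) [∀ i, Preorder (C i)], Filter (∀ i, C i)
  | 0, _, _ => pure finZeroElim
  | _ + 1, C, _ =>
    (iterAtTop fun i => C i.succ).bind fun a => (atTop : Filter (C 0)).map fun b => Fin.cons b a

theorem eventually_iterAtTop_zero {C : Fin 0 → Type*} [∀ i, Preorder (C i)]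
    {P : (∀ i, C i) → Prop} : (∀ᶠ α in iterAtTop C, P α) ↔ P finZeroElim :=
  eventually_pure

theorem eventually_iterAtTop_succ {n : ℕ} {C : Fin (n + 1) → Type*} [∀ i, Preorder (C i)]
    {P : (∀ i, C i) → Prop} :
    (∀ᶠ α in iterAtTop C, P α) ↔
      ∀ᶠ a in iterAtTop fun i => C i.succ, ∀ᶠ b in atTop, P (Fin.cons b a) :=
  Iff.rfl

instance iterAtTop_neBot {n : ℕ} (C : Fin n → Type*) [∀ i, Preorder (C i)]
    [∀ i, IsDirectedOrder (C i)] [∀ i, Nonempty (C i)] : (iterAtTop C).NeBot := by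
  induction n with
  | zero => exact pure_neBot
  | succ n ih =>
    have := ih fun i => C i.succ
    refine ⟨fun h => ?_⟩
    have hF : ∀ᶠ α in iterAtTop C, False := by simp [h]
    obtain ⟨_, ha⟩ := (eventually_iterAtTop_succ.1 hF).exists
    exact ha.exists.elim fun _ => id

/-- The lower bound functions defining the sub-basic sets are eventually dominated. -/
theorem eventually_iterAtTop_le {n : ℕ} {C : Fin n → Type*} [∀ i, Preorder (C i)]
    [∀ i, IsDirectedOrder (C i)] [∀ i, Nonempty (C i)] (i : Fin n) (G : (∀ i, C i) → C i)
    (hG : ∀ α β : ∀ i, C i, (∀ j, i < j → α j = β j) → G α = G β) :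
    ∀ᶠ α in iterAtTop C, G α ≤ α i := by
  induction n with
  | zero => exact i.elim0
  | succ n ih =>
    obtain ⟨b₀⟩ := ‹∀ i, Nonempty (C i)› 0
    rw [eventually_iterAtTop_succ]
    have key (a : ∀ i : Fin n, C i.succ) (b : C 0) : G (Fin.cons b a) = G (Fin.cons b₀ a) := by
      refine hG _ _ fun j hj => ?_
      obtain ⟨j, rfl⟩ := Fin.exists_succ_eq.2 (Fin.ne_zero_of_lt hj)
      simp
    simp only [key]
    cases i using Fin.cases with
    | zero => exact .of_forall fun a => eventually_ge_atTop _
    | succ i =>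
      have h := ih (C := fun i => C i.succ) i (fun a => G (Fin.cons b₀ a)) fun α β h => by
        refine hG _ _ fun j hj => ?_
        obtain ⟨j, rfl⟩ := Fin.exists_succ_eq.2 (Fin.ne_zero_of_lt hj)
        simpa using h j (Fin.succ_lt_succ_iff.1 hj)
      exact h.mono fun a ha => .of_forall fun b => by simpa using ha

/-- Sets of the iterated filter contain a finite intersection of sub-basic sets. -/
theorem exists_lowerBounds_of_eventually_iterAtTop {n : ℕ} {C : Fin n → Type*}
    [∀ i, Preorder (C i)] [∀ i, IsDirectedOrder (C i)] [∀ i, Nonempty (C i)]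
    {P : (∀ i, C i) → Prop} (hP : ∀ᶠ α in iterAtTop C, P α) :
    ∃ G : ∀ i, (∀ i, C i) → C i,
      (∀ i (α β : ∀ i, C i), (∀ j, i < j → α j = β j) → G i α = G i β) ∧
        ∀ α, (∀ i, G i α ≤ α i) → P α := by
  induction n with
  | zero =>
    refine ⟨fun i => i.elim0, fun i => i.elim0, fun α _ => ?_⟩
    rw [eventually_iterAtTop_zero] at hP
    convert hP
  | succ n ih =>
    rw [eventually_iterAtTop_succ] at hP
    obtain ⟨G, hG, hGP⟩ := ih hP
    have hb (a : ∀ i : Fin n, C i.succ) :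
        ∃ b₀ : C 0, (∀ i, G i a ≤ a i) → ∀ b, b₀ ≤ b → P (Fin.cons b a) := by
      by_cases ha : ∀ i, G i a ≤ a i
      · obtain ⟨b₀, hb₀⟩ := eventually_atTop.1 (hGP a ha)
        exact ⟨b₀, fun _ => hb₀⟩
      · exact ⟨Classical.arbitrary _, fun h => absurd h ha⟩
    choose b₀ hb₀ using hb
    refine ⟨Fin.cons (fun α => b₀ (Fin.tail α)) fun i α => G i (Fin.tail α), ?_, ?_⟩
    · intro i α β h
      cases i using Fin.cases with
      | zero =>
        have : Fin.tail α = Fin.tail β := funext fun j => h _ j.succ_pos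
        simp [this]
      | succ i => simpa using! hG i (Fin.tail α) (Fin.tail β) fun j hj => h j.succ (Fin.succ_lt_succ_iff.2 hj)
    · intro α h
      rw [← Fin.cons_self_tail α]
      exact hb₀ _ (fun i => h i.succ) _ (by simpa using h 0)

/-- Dominated convergence along the iterated filter. -/
theorem tendsto_lintegral_iterAtTop {n : ℕ} {C : Fin n → Type*} [∀ i, Preorder (C i)]
    [∀ i, IsDirectedOrder (C i)] [∀ i, Nonempty (C i)] [∀ i, Countable (C i)]
    {X : Type*} [MeasurableSpace X] {ν : Measure X} {f : (∀ i, C i) → X → ℝ≥0∞} (g : X → ℝ≥0∞)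
    (hf : ∀ α, Measurable (f α)) (hfg : ∀ α, f α ≤ g) (hg : ∫⁻ x, g x ∂ν ≠ ∞)
    (h : ∀ᵐ x ∂ν, Tendsto (fun α => f α x) (iterAtTop C) (𝓝 0)) :
    Tendsto (fun α => ∫⁻ x, f α x ∂ν) (iterAtTop C) (𝓝 0) := by
  induction n with
  | zero =>
    have h0 : ∀ᵐ x ∂ν, f finZeroElim x = 0 :=
      h.mono fun x hx => tendsto_nhds_unique (tendsto_pure_nhds _ _) hx
    have : ∫⁻ x, f finZeroElim x ∂ν = 0 := by simp [lintegral_congr_ae h0]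
    rw [← this]
    exact tendsto_pure_nhds _ _
  | succ n ih =>
    have key := ih (C := fun i => C i.succ)
      (f := fun a x => limsup (fun b => f (Fin.cons b a) x) atTop)
      (fun a => measurable_limsup_of_countable fun b => hf _)
      (fun a x => limsup_le_of_le (h := .of_forall fun b => hfg _ x)) <| by
        refine h.mono fun x hx => ENNReal.tendsto_nhds_zero.2 fun ε hε => ?_
        have := eventually_iterAtTop_succ.1 (ENNReal.tendsto_nhds_zero.1 hx ε hε)
        exact this.mono fun a ha => limsup_le_of_le (h := ha)
    refine ENNReal.nhds_zero_basis.tendsto_right_iff.2 fun ε hε => eventually_iterAtTop_succ.2 ?_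
    refine (key.eventually (gt_mem_nhds hε)).mono fun a ha => ?_
    exact eventually_lt_of_limsup_lt <|
      (limsup_lintegral_le_of_countable g (fun b => hf (Fin.cons b a)) (fun b => hfg _) hg).trans_lt
        ha

theorem finite_measurableSet_generateFrom {Y : Type*} {C : Set (Set Y)} (hC : C.Finite) :
    {s : Set Y | MeasurableSet[MeasurableSpace.generateFrom C] s}.Finite := by
  have := hC.to_subtype
  have hle : MeasurableSpace.generateFrom C ≤
      MeasurableSpace.comap (fun y (s : C) => y ∈ s.1) ⊤ :=
    MeasurableSpace.generateFrom_le fun s hs => ⟨{p | p ⟨s, hs⟩}, trivial, rfl⟩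
  refine (Set.finite_range fun T : Set (C → Prop) => (fun y (s : C) => y ∈ s.1) ⁻¹' T).subset ?_
  intro s hs
  obtain ⟨T, -, rfl⟩ := hle s hs
  exact ⟨T, rfl⟩

section ColAlg

variable {Y : Type} [TopologicalSpace Y]

theorem isColAlg_iff {B : MeasurableSpace Y} :
    IsColAlg B ↔ ∃ C : Set (Set Y), C.Finite ∧ (∀ s ∈ C, IsClopen s) ∧
      B = MeasurableSpace.generateFrom C := by
  constructor
  · rintro ⟨hfin, C, hC, rfl⟩
    exact ⟨C, hfin.subset fun s hs => MeasurableSpace.measurableSet_generateFrom hs, hC, rfl⟩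
  · rintro ⟨C, hfin, hC, rfl⟩
    exact ⟨finite_measurableSet_generateFrom hfin, C, hC, rfl⟩

instance : Nonempty {B : MeasurableSpace Y // IsColAlg B} :=
  ⟨_, isColAlg_iff.2 ⟨∅, Set.finite_empty, by simp, rfl⟩⟩

instance : IsDirectedOrder {B : MeasurableSpace Y // IsColAlg B} := by
  refine ⟨fun ⟨B₁, h₁⟩ ⟨B₂, h₂⟩ => ?_⟩
  obtain ⟨C₁, hf₁, hC₁, rfl⟩ := isColAlg_iff.1 h₁
  obtain ⟨C₂, hf₂, hC₂, rfl⟩ := isColAlg_iff.1 h₂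
  exact ⟨⟨_, isColAlg_iff.2 ⟨C₁ ∪ C₂, hf₁.union hf₂,
    fun s hs => hs.elim (hC₁ s) (hC₂ s), rfl⟩⟩,
    MeasurableSpace.generateFrom_mono Set.subset_union_left,
    MeasurableSpace.generateFrom_mono Set.subset_union_right⟩

theorem IsSubCantor.countable_setOf_isClopen (h : IsSubCantor Y) :
    {s : Set Y | IsClopen s}.Countable := by
  obtain ⟨t, ht, ⟨e⟩⟩ := h
  have := isCompact_iff_compactSpace.1 ht
  have := e.symm.compactSpace
  have := e.isEmbedding.t2Space
  have := e.isEmbedding.secondCountableTopology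
  have : TotallyDisconnectedSpace Y := e.symm.totallyDisconnectedSpace
  have := TopologicalSpace.Clopens.countable_iff_secondCountable.2 ‹SecondCountableTopology Y›
  refine (Set.countable_range fun s : TopologicalSpace.Clopens Y => (s : Set Y)).mono ?_
  exact fun s hs => ⟨⟨s, hs⟩, rfl⟩

theorem IsSubCantor.countable_colAlg (h : IsSubCantor Y) :
    Countable {B : MeasurableSpace Y // IsColAlg B} := by
  refine Set.Countable.to_subtype (s := {B | IsColAlg B}) ?_
  refine ((Set.countable_ofPred_finite_subset h.countable_setOf_isClopen).image
    MeasurableSpace.generateFrom).mono fun B hB => ?_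
  obtain ⟨C, hf, hC, rfl⟩ := isColAlg_iff.1 hB
  exact ⟨C, ⟨hf, hC⟩, rfl⟩

end ColAlg

section ColTuple

variable {Z : ℕ → Type} [∀ j, TopologicalSpace (Z j)] {k : ℕ}

/-- The filter of sets of colourings containing all sufficiently fine ones. -/
def fineColourings (Z : ℕ → Type) [∀ j, TopologicalSpace (Z j)] (k : ℕ) :
    Filter (ColTuple Z k) :=
  iterAtTop fun i : Fin (k + 1) => {B : MeasurableSpace (Z i.val) // IsColAlg B}

theorem mem_fineColourings_of_isOpen {U : Set (ColTuple Z k)} (hU : IsOpen U)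
    (hne : U.Nonempty) : U ∈ fineColourings Z k := by
  induction hU with
  | basic U hU =>
    obtain ⟨i, F, rfl⟩ := hU
    refine eventually_iterAtTop_le i (fun α => F fun i' _ => α i') fun α β h => ?_
    congr 1
    funext j hj
    exact h j hj
  | univ => exact univ_mem
  | inter U V _ _ ihU ihV =>
    exact inter_mem (ihU (hne.mono Set.inter_subset_left)) (ihV (hne.mono Set.inter_subset_right))
  | sUnion S _ ih =>
    obtain ⟨α, U, hU, hα⟩ := hne
    exact mem_of_superset (ih U hU ⟨α, hα⟩) (Set.subset_sUnion_of_mem hU)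

theorem eventually_fineColourings_iff {P : ColTuple Z k → Prop} :
    (∀ᶠ α in fineColourings Z k, P α) ↔
      ∃ U : Set (ColTuple Z k), IsOpen U ∧ U.Nonempty ∧ ∀ α ∈ U, P α := by
  classical
  refine ⟨fun h => ?_, fun ⟨U, hU, hne, hP⟩ =>
    mem_of_superset (mem_fineColourings_of_isOpen hU hne) hP⟩
  obtain ⟨G, hG, hGP⟩ := exists_lowerBounds_of_eventually_iterAtTop h
  refine ⟨⋂ i, {α | G i α ≤ α i}, isOpen_iInter_of_finite fun i => ?_, ?_,
    fun α hα => hGP α (Set.mem_iInter.1 hα)⟩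
  · refine TopologicalSpace.isOpen_generateFrom_of_mem ⟨i, fun γ =>
      G i fun j => if hj : i < j then γ j hj else Classical.arbitrary _, Set.ext fun α => ?_⟩
    have : G i α = G i fun j => if i < j then α j else Classical.arbitrary _ :=
      hG i _ _ fun j hj => by simp [hj]
    change G i α ≤ α i ↔ _
    rw [this]
    rfl
  · obtain ⟨α, hα⟩ :=
      (eventually_all.2 fun i => eventually_iterAtTop_le i (G i) (hG i)).exists
    exact ⟨α, Set.mem_iInter.2 hα⟩

theorem tendstoFine_iff {c : ColTuple Z k → ℝ} :
    TendstoFine Z k c ↔ Tendsto c (fineColourings Z k) (𝓝 0) := by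
  rw [Metric.nhds_basis_closedBall.tendsto_right_iff]
  simp only [TendstoFine, mem_closedBall_zero_iff, Real.norm_eq_abs,
    eventually_fineColourings_iff]

end ColTuple

/-- Dominated convergence along increasingly fine colourings: if
`F_α : X → [-1,1]` are measurable and `F_α(x) → 0` as `α → ∞` for `ν`-almost every `x`,
then `∫ F_α dν → 0` as `α → ∞`. -/
theorem dominated_convergence_fine_colourings
    (Z : ℕ → Type) [∀ j, TopologicalSpace (Z j)] (hZ : ∀ j, IsSubCantor (Z j))
    (k : ℕ) (hZk : ∀ j, k < j → Subsingleton (Z j))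
    (X : Type) [MeasurableSpace X] (ν : Measure X) [IsProbabilityMeasure ν]
    (F : ColTuple Z k → X → ℝ)
    (hFmeas : ∀ α, Measurable (F α))
    (hFbdd : ∀ α x, F α x ∈ Set.Icc (-1 : ℝ) 1)
    (hae : ∀ᵐ x ∂ν, TendstoFine Z k fun α => F α x) :
    TendstoFine Z k fun α => ∫ x, F α x ∂ν := by
  have (i : Fin (k + 1)) : Countable {B : MeasurableSpace (Z i.val) // IsColAlg B} :=
    (hZ i).countable_colAlg
  simp only [tendstoFine_iff] at hae ⊢
  have key : Tendsto (fun α => ∫⁻ x, ‖F α x‖ₑ ∂ν) (fineColourings Z k) (𝓝 0) := by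
    refine tendsto_lintegral_iterAtTop 1 (fun α => (hFmeas α).enorm) (fun α x => ?_) (by simp) ?_
    · rw [Pi.one_apply, ← ofReal_norm, ENNReal.ofReal_le_one]
      exact abs_le.2 (hFbdd α x)
    · exact hae.mono fun x hx => tendsto_zero_iff_enorm_tendsto_zero.1 hx
  have key' : Tendsto (fun α => ‖∫ x, F α x ∂ν‖ₑ) (fineColourings Z k) (𝓝 0) :=
    tendsto_of_tendsto_of_tendsto_of_le_of_le tendsto_const_nhds key (fun _ => zero_le)
      fun _ => enorm_integral_le_lintegral_enorm _
  exact tendsto_zero_iff_enorm_tendsto_zero.2 key'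
end

section
/- Let Z be a sub-Cantor palette of order k, let V be a finite vertex set, and let 0 ≤ j ≤ k. Suppose that to each tuple (B_{j+1},…,B_k) ∈ Col_{j+1}(Z)×…×Col_k(Z) are assigned a finite-dimensional real Hilbert space H, a Borel probability measure μ on Y := Z_j^{Inj([j],V)}, and a bounded measurable function F: Y → H (so H, μ, F depend only on the components of index > j of the colouring, and on V). For α = (B_0,…,B_k) ∈ Col(Z), let the cells {C_a} be the atoms of the finite σ-algebra on Y generated coordinatewise by B_j (i.e., products over Inj([j],V) of atoms of B_j). Then Σ_a μ(C_a) · ∫_Y ‖ F(z) − ∫_Y F dw (μ|C_a)(dw) ‖_H d(μ|C_a)(z) = o_{α→∞}(1), where the summands with μ(C_a)=0 are omitted and (μ|C) := μ(·∩C)/μ(C) denotes conditioning. -/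
open MeasureTheory

open ProbabilityTheory

/-- The space `Y = Z_j^{Inj([j],V)}` of order-`j` colourings of the `j`-edges of `V`. -/
def EdgeSpace (Z : ℕ → Type) (V : Type) (j : ℕ) : Type := (Fin j ↪ V) → Z j

instance (Z : ℕ → Type) [∀ i, TopologicalSpace (Z i)] (V : Type) (j : ℕ) :
    TopologicalSpace (EdgeSpace Z V j) :=
  inferInstanceAs (TopologicalSpace ((Fin j ↪ V) → Z j))

instance (Z : ℕ → Type) [∀ i, TopologicalSpace (Z i)] (V : Type) (j : ℕ) :
    MeasurableSpace (EdgeSpace Z V j) := borel _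

instance (Z : ℕ → Type) [∀ i, TopologicalSpace (Z i)] (V : Type) (j : ℕ) :
    BorelSpace (EdgeSpace Z V j) := ⟨rfl⟩

/-- The tuples `(B_{j+1}, …, B_k)` of colouring algebras of index `> j`. -/
def ColTail (Z : ℕ → Type) [∀ i, TopologicalSpace (Z i)] (k j : ℕ) : Type :=
  ∀ i : Fin (k + 1), j < i.val → {B : MeasurableSpace (Z i.val) // IsColAlg B}

/-- The components of index `> j` of a colouring tuple. -/
def ColTuple.tail {Z : ℕ → Type} [∀ i, TopologicalSpace (Z i)] {k : ℕ}
    (α : ColTuple Z k) (j : ℕ) : ColTail Z k j := fun i _ => α i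

/-- The σ-algebra on `Y = Z_j^{Inj([j],V)}` generated coordinatewise by the `j`-th
component `B_j` of a colouring tuple `α`; its atoms are the cells `C_a`. -/
def cellAlg {Z : ℕ → Type} [∀ i, TopologicalSpace (Z i)] {k : ℕ} (V : Type) {j : ℕ}
    (hj : j ≤ k) (α : ColTuple Z k) : MeasurableSpace (EdgeSpace Z V j) :=
  @MeasurableSpace.pi (Fin j ↪ V) (fun _ => Z j) fun _ => (α ⟨j, Nat.lt_succ_of_le hj⟩).val

/-- The atom of the σ-algebra `m` containing the point `y`. -/
def mAtom {Y : Type} (m : MeasurableSpace Y) (y : Y) : Set Y :=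
  ⋂₀ {s : Set Y | MeasurableSet[m] s ∧ y ∈ s}

section Atoms

variable {Y : Type} {m : MeasurableSpace Y}

theorem mem_mAtom_self (m : MeasurableSpace Y) (y : Y) : y ∈ mAtom m y :=
  fun _ hs => hs.2

theorem mem_iff_of_mem_mAtom {y y' : Y} (h : y' ∈ mAtom m y) {s : Set Y}
    (hs : MeasurableSet[m] s) : y ∈ s ↔ y' ∈ s := by
  refine ⟨fun hy => h s ⟨hs, hy⟩, fun hy' => ?_⟩
  by_contra hy
  exact h sᶜ ⟨hs.compl, hy⟩ hy'

theorem mAtom_eq_of_mem {y y' : Y} (h : y' ∈ mAtom m y) : mAtom m y' = mAtom m y := by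
  have hset : {s | MeasurableSet[m] s ∧ y' ∈ s} = {s | MeasurableSet[m] s ∧ y ∈ s} :=
    Set.ext fun s => and_congr_right fun hs => (mem_iff_of_mem_mAtom h hs).symm
  rw [mAtom, hset, mAtom]

theorem pairwiseDisjoint_mAtom (m : MeasurableSpace Y) :
    {C : Set Y | ∃ y, C = mAtom m y}.PairwiseDisjoint id := by
  rintro _ ⟨y, rfl⟩ _ ⟨y', rfl⟩ hne
  refine Set.disjoint_left.2 fun z hz hz' => hne ?_
  rw [← mAtom_eq_of_mem hz, ← mAtom_eq_of_mem hz']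

theorem mAtom_pi {ι X : Type} (B : MeasurableSpace X) (y : ι → X) :
    mAtom (@MeasurableSpace.pi ι (fun _ => X) fun _ => B) y =
      ⋂ i, (fun z : ι → X => z i) ⁻¹' mAtom B (y i) := by
  let saturated : MeasurableSpace (ι → X) :=
    { MeasurableSet' := fun s => ∀ y y' : ι → X,
        (∀ i, y' i ∈ mAtom B (y i)) → (y ∈ s ↔ y' ∈ s)
      measurableSet_empty := fun _ _ _ => Iff.rfl
      measurableSet_compl := fun s hs y y' h => not_congr (hs y y' h)
      measurableSet_iUnion := fun f hf y y' h => by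
        simp only [Set.mem_iUnion]
        exact exists_congr fun n => hf n y y' h }
  have hle : (@MeasurableSpace.pi ι (fun _ => X) fun _ => B) ≤ saturated := by
    refine iSup_le fun i => ?_
    rintro _ ⟨s, hs, rfl⟩ y y' h
    exact mem_iff_of_mem_mAtom (h i) hs
  ext z
  simp only [Set.mem_iInter, Set.mem_preimage]
  constructor
  · intro hz i s hs
    exact hz _ ⟨le_iSup (fun i => MeasurableSpace.comap (fun w : ι → X => w i) B) i _
      ⟨s, hs.1, rfl⟩, hs.2⟩
  · intro hz s hs
    exact (hle s hs.1 y z hz).1 hs.2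

end Atoms

section ColouringAlgebras

variable {X : Type} [TopologicalSpace X]

theorem IsColAlg.le_borel {B : MeasurableSpace X} (hB : IsColAlg B) : B ≤ borel X := by
  obtain ⟨-, C, hC, rfl⟩ := hB
  exact MeasurableSpace.generateFrom_le fun s hs =>
    MeasurableSpace.measurableSet_generateFrom (hC s hs).isOpen

theorem IsColAlg.measurableSet_mAtom {B : MeasurableSpace X} (hB : IsColAlg B) (x : X) :
    MeasurableSet[borel X] (mAtom B x) :=
  @MeasurableSet.sInter X (borel X) _ (hB.1.subset fun _ hs => hs.1).countable
    fun s hs => hB.le_borel s hs.1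

theorem isColAlg_comap_top {A : Type} [Finite A] [TopologicalSpace A] [DiscreteTopology A]
    {r : X → A} (hr : Continuous r) : IsColAlg (MeasurableSpace.comap r ⊤) := by
  refine ⟨(Set.finite_range (Set.preimage r)).subset ?_,
    {s | MeasurableSet[MeasurableSpace.comap r ⊤] s}, ?_,
    (@MeasurableSpace.generateFrom_measurableSet X (MeasurableSpace.comap r ⊤)).symm⟩
  · rintro _ ⟨s, -, rfl⟩
    exact ⟨s, rfl⟩
  · rintro _ ⟨s, -, rfl⟩
    exact (isClopen_discrete s).preimage hr

theorem isColAlg_bot : IsColAlg (⊥ : MeasurableSpace X) := by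
  simpa using isColAlg_comap_top (X := X) (r := fun _ => ()) continuous_const

theorem measurableSet_mAtom_pi {ι : Type} [Finite ι] [MeasurableSpace (ι → X)]
    [BorelSpace (ι → X)] {B : MeasurableSpace X} (hB : IsColAlg B) (y : ι → X) :
    MeasurableSet (mAtom (@MeasurableSpace.pi ι (fun _ => X) fun _ => B) y) := by
  let : MeasurableSpace X := borel X
  have : BorelSpace X := ⟨rfl⟩
  rw [mAtom_pi]
  exact MeasurableSet.iInter fun i =>
    (continuous_apply (A := fun _ : ι => X) i).measurable (hB.measurableSet_mAtom (y i))

end ColouringAlgebras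

/-- A continuous function on a finite power of a sub-Cantor space is nearly constant on the
cells of all sufficiently fine colouring algebras. -/
theorem exists_isColAlg_forall_dist_le {ι X : Type} [TopologicalSpace X]
    (hX : IsSubCantor X) {E : Type*} [PseudoMetricSpace E] {G : (ι → X) → E}
    (hG : Continuous G) {δ : ℝ} (hδ : 0 < δ) :
    ∃ B₀ : MeasurableSpace X, IsColAlg B₀ ∧ ∀ B : MeasurableSpace X, B₀ ≤ B →
      ∀ y, ∀ z ∈ mAtom (@MeasurableSpace.pi ι (fun _ => X) fun _ => B) y,
        dist (G z) (G y) ≤ δ := by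
  obtain ⟨s, hs, ⟨e⟩⟩ := hX
  have : CompactSpace s := isCompact_iff_compactSpace.1 hs
  have : CompactSpace X := e.symm.compactSpace
  let c : X → ℕ → Bool := fun x => (e x : ℕ → Bool)
  have hc : Continuous c := continuous_subtype_val.comp e.continuous
  have hcinj : Function.Injective c := Subtype.val_injective.comp e.injective
  have hci : ∀ n, Continuous fun x => c x n := fun n => (continuous_apply n).comp hc
  let K : ℕ → Set ((ι → X) × (ι → X)) := fun n =>
    {p | (∀ i, ∀ l < n, c (p.1 i) l = c (p.2 i) l) ∧ δ ≤ dist (G p.1) (G p.2)}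
  have hKcl : ∀ n, IsClosed (K n) := by
    intro n
    have hag : IsClosed {p : (ι → X) × (ι → X) | ∀ i, ∀ l < n, c (p.1 i) l = c (p.2 i) l} := by
      simp only [Set.ofPred_forall]
      refine isClosed_iInter fun i => isClosed_iInter fun l => isClosed_iInter fun _ => ?_
      exact isClosed_eq ((hci l).comp ((continuous_apply i).comp continuous_fst))
        ((hci l).comp ((continuous_apply i).comp continuous_snd))
    exact hag.inter (isClosed_le continuous_const
      ((hG.comp continuous_fst).dist (hG.comp continuous_snd)))
  obtain ⟨n, hn⟩ : ∃ n, ¬ (K n).Nonempty := by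
    by_contra! hne
    obtain ⟨p, hp⟩ := IsCompact.nonempty_iInter_of_sequence_nonempty_isCompact_isClosed K
      (fun n p hp => ⟨fun i l hl => hp.1 i l (hl.trans n.lt_succ_self), hp.2⟩) hne
      (hKcl 0).isCompact hKcl
    rw [Set.mem_iInter] at hp
    have heq : p.1 = p.2 :=
      funext fun i => hcinj (funext fun l => (hp (l + 1)).1 i l l.lt_succ_self)
    have := (hp 0).2
    rw [heq, dist_self] at this
    exact this.not_gt hδ
  have hr : Continuous fun (x : X) (l : Fin n) => c x l := continuous_pi fun l => hci l
  refine ⟨_, isColAlg_comap_top hr, fun B hB y z hz => ?_⟩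
  by_contra! hlt
  refine hn ⟨(z, y), fun i l hl => ?_, hlt.le⟩
  rw [mAtom_pi, Set.mem_iInter] at hz
  have := hz i ((fun (x : X) (l : Fin n) => c x l) ⁻¹' {fun l : Fin n => c (y i) l})
    ⟨hB _ ⟨_, trivial, rfl⟩, rfl⟩
  exact congrFun this ⟨l, hl⟩

section Oscillation

variable {Y : Type*} [MeasurableSpace Y] {E : Type*} [NormedAddCommGroup E] [NormedSpace ℝ E]
  [CompleteSpace E] {μ : Measure Y} [IsFiniteMeasure μ] {F : Y → E}

theorem integral_norm_sub_integral_le [IsProbabilityMeasure μ] (hF : Integrable F μ) (c : E) :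
    ∫ z, ‖F z - ∫ w, F w ∂μ‖ ∂μ ≤ 2 * ∫ z, ‖F z - c‖ ∂μ := by
  have hFc : Integrable (fun z => F z - c) μ := hF.sub (integrable_const c)
  have havg : ‖c - ∫ w, F w ∂μ‖ ≤ ∫ z, ‖F z - c‖ ∂μ := by
    have h : ∫ z, (F z - c) ∂μ = (∫ w, F w ∂μ) - c := by
      rw [integral_sub hF (integrable_const c)]
      simp
    rw [norm_sub_rev, ← h]
    exact norm_integral_le_integral_norm _
  calc ∫ z, ‖F z - ∫ w, F w ∂μ‖ ∂μ
      ≤ ∫ z, (‖F z - c‖ + ‖c - ∫ w, F w ∂μ‖) ∂μ := by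
        refine integral_mono (hF.sub (integrable_const _)).norm
          (hFc.norm.add (integrable_const _)) fun z => ?_
        exact norm_sub_le_norm_sub_add_norm_sub _ _ _
    _ = (∫ z, ‖F z - c‖ ∂μ) + ‖c - ∫ w, F w ∂μ‖ := by
        rw [integral_add hFc.norm (integrable_const _)]
        simp
    _ ≤ 2 * ∫ z, ‖F z - c‖ ∂μ := by linarith

theorem measure_mul_integral_cond_le (hF : Integrable F μ) (C : Set Y) (c : E) :
    (μ C).toReal * ∫ z, ‖F z - ∫ w, F w ∂μ[|C]‖ ∂μ[|C] ≤ 2 * ∫ z in C, ‖F z - c‖ ∂μ := by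
  by_cases hC : μ C = 0
  · rw [hC, ENNReal.toReal_zero, zero_mul]
    positivity
  have := cond_isProbabilityMeasure hC
  have hint : Integrable F (μ[|C]) :=
    hF.restrict.smul_measure (ENNReal.inv_ne_top.2 hC)
  have hC' : (μ C).toReal ≠ 0 := ENNReal.toReal_ne_zero.2 ⟨hC, measure_ne_top _ _⟩
  calc (μ C).toReal * ∫ z, ‖F z - ∫ w, F w ∂μ[|C]‖ ∂μ[|C]
      ≤ (μ C).toReal * (2 * ∫ z, ‖F z - c‖ ∂μ[|C]) := by
        gcongr
        exact integral_norm_sub_integral_le hint c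
    _ = 2 * ∫ z in C, ‖F z - c‖ ∂μ := by
        rw [ProbabilityTheory.cond, integral_smul_measure, ENNReal.toReal_inv, smul_eq_mul]
        field_simp

theorem finsum_mem_le_of_forall_sum_le {α : Type*} {s : Set α} {f : α → ℝ} {b : ℝ}
    (h : ∀ t : Finset α, ↑t ⊆ s → ∑ a ∈ t, f a ≤ b) : ∑ᶠ a ∈ s, f a ≤ b := by
  by_cases hs : (s ∩ f.support).Finite
  · rw [finsum_mem_eq_sum f hs]
    exact h _ (by simp)
  · rw [finsum_mem_eq_zero_of_infinite hs]
    simpa using h ∅ (by simp)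

theorem finsum_mem_measure_mul_integral_cond_le {G : Y → E} (hF : Integrable F μ)
    (hG : Integrable G μ) {δ : ℝ} {s : Set (Set Y)} (hs : ∀ C ∈ s, MeasurableSet C)
    (hdisj : s.PairwiseDisjoint id)
    (hosc : ∀ C ∈ s, ∃ y, ∀ z ∈ C, dist (G z) (G y) ≤ δ) (hδ : 0 ≤ δ) :
    ∑ᶠ C ∈ s, (μ C).toReal * ∫ z, ‖F z - ∫ w, F w ∂μ[|C]‖ ∂μ[|C] ≤
      2 * ∫ z, (‖F z - G z‖ + δ) ∂μ := by
  have hint : Integrable (fun z => ‖F z - G z‖ + δ) μ :=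
    (hF.sub hG).norm.add (integrable_const δ)
  refine finsum_mem_le_of_forall_sum_le fun t ht => ?_
  calc ∑ C ∈ t, (μ C).toReal * ∫ z, ‖F z - ∫ w, F w ∂μ[|C]‖ ∂μ[|C]
      ≤ ∑ C ∈ t, 2 * ∫ z in C, (‖F z - G z‖ + δ) ∂μ := by
        refine Finset.sum_le_sum fun C hC => ?_
        obtain ⟨y, hy⟩ := hosc C (ht hC)
        refine (measure_mul_integral_cond_le hF C (G y)).trans ?_
        gcongr 2 * ?_
        refine setIntegral_mono_on (hF.sub (integrable_const _)).norm.integrableOn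
          hint.integrableOn (hs C (ht hC)) fun z hz => ?_
        have h := hy z hz
        rw [dist_eq_norm] at h
        exact (norm_sub_le_norm_sub_add_norm_sub _ _ _).trans (by gcongr)
    _ = 2 * ∫ z in ⋃ C ∈ t, C, (‖F z - G z‖ + δ) ∂μ := by
        rw [← Finset.mul_sum, integral_biUnion_finset t (fun C hC => hs C (ht hC))
          (fun C hC D hD hne => hdisj (ht hC) (ht hD) hne) fun C _ => hint.integrableOn]
    _ ≤ 2 * ∫ z, (‖F z - G z‖ + δ) ∂μ := by
        gcongr
        · exact Filter.Eventually.of_forall fun z => by positivity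
        · exact Measure.restrict_le_self

end Oscillation

theorem exists_isColAlg_finsum_mAtom_le {ι X : Type} [Finite ι] [TopologicalSpace X]
    (hX : IsSubCantor X) [MeasurableSpace (ι → X)] [BorelSpace (ι → X)] {E : Type*}
    [NormedAddCommGroup E] [NormedSpace ℝ E] [CompleteSpace E] {μ : Measure (ι → X)}
    [IsProbabilityMeasure μ] {F : (ι → X) → E} (hF : Integrable F μ) {ε : ℝ} (hε : 0 < ε) :
    ∃ B₀ : MeasurableSpace X, IsColAlg B₀ ∧ ∀ B : MeasurableSpace X, IsColAlg B → B₀ ≤ B →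
      ∑ᶠ C ∈ {C | ∃ y, C = mAtom (@MeasurableSpace.pi ι (fun _ => X) fun _ => B) y},
        (μ C).toReal * ∫ z, ‖F z - ∫ w, F w ∂μ[|C]‖ ∂μ[|C] ≤ ε := by
  have : TopologicalSpace.MetrizableSpace X := by
    obtain ⟨s, -, ⟨e⟩⟩ := hX
    exact e.isEmbedding.metrizableSpace
  let := TopologicalSpace.metrizableSpaceMetric X
  have : NormalSpace (ι → X) := by
    have := Fintype.ofFinite ι
    infer_instance
  have : TopologicalSpace.PseudoMetrizableSpace (ι → X) := by
    have := Fintype.ofFinite ι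
    infer_instance
  obtain ⟨G, hFG, hG⟩ := hF.exists_boundedContinuous_integral_sub_le (half_pos (half_pos hε))
  obtain ⟨B₀, hB₀, h⟩ :=
    exists_isColAlg_forall_dist_le hX G.continuous (half_pos (half_pos hε))
  refine ⟨B₀, hB₀, fun B hB hle => ?_⟩
  refine (finsum_mem_measure_mul_integral_cond_le (δ := ε / 2 / 2) hF hG ?_
    (pairwiseDisjoint_mAtom _) ?_ (by positivity)).trans ?_
  · rintro _ ⟨y, rfl⟩
    exact measurableSet_mAtom_pi hB y
  · rintro _ ⟨y, rfl⟩
    exact ⟨y, h B hle y⟩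
  · have hFG' : Integrable (fun z => ‖F z - G z‖) μ := (hF.sub hG).norm
    rw [integral_add hFG' (integrable_const _)]
    simp only [integral_const, probReal_univ, one_smul]
    linarith

theorem nonempty_colSubbasis {Z : ℕ → Type} [∀ j, TopologicalSpace (Z j)] {k : ℕ}
    {U : Set (ColTuple Z k)} (hU : U ∈ colSubbasis Z k) : U.Nonempty := by
  obtain ⟨i, F, rfl⟩ := hU
  let β : ColTuple Z k := fun _ => ⟨⊥, isColAlg_bot⟩
  refine ⟨Function.update β i (F fun i' _ => β i'), ?_⟩
  have h : (fun i' (_ : i < i') => Function.update β i (F fun i' _ => β i') i') =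
      fun i' _ => β i' :=
    funext fun i' => funext fun hi => Function.update_of_ne hi.ne' _ _
  change (F fun i' _ => Function.update β i (F fun i' _ => β i') i').val ≤
    (Function.update β i (F fun i' _ => β i') i).val
  rw [Function.update_self, h]

/-- Littlewood's principle for fine colourings.  Given, for each tuple
`t = (B_{j+1},…,B_k)`, a finite-dimensional real Hilbert space `H t`, a Borel probability
measure `μ t` on `Y`, and a bounded measurable `F t : Y → H t`, the mean conditional
oscillation of `F` over the cells of `α` tends to `0` as the colouring `α` becomes
sufficiently fine. -/
theorem littlewood_principle_fine_colourings
    (Z : ℕ → Type) [∀ i, TopologicalSpace (Z i)] (hZ : ∀ i, IsSubCantor (Z i))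
    (k : ℕ) (hZk : ∀ i, k < i → Subsingleton (Z i))
    (V : Type) [Fintype V] (j : ℕ) (hj : j ≤ k)
    (H : ColTail Z k j → Type)
    [∀ t, NormedAddCommGroup (H t)] [∀ t, InnerProductSpace ℝ (H t)]
    [∀ t, FiniteDimensional ℝ (H t)]
    [∀ t, MeasurableSpace (H t)] [∀ t, BorelSpace (H t)]
    (μ : ColTail Z k j → Measure (EdgeSpace Z V j))
    (hμ : ∀ t, IsProbabilityMeasure (μ t))
    (F : ∀ t : ColTail Z k j, EdgeSpace Z V j → H t)
    (hFmeas : ∀ t, Measurable (F t))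
    (hFbdd : ∀ t, ∃ c : ℝ, ∀ y, ‖F t y‖ ≤ c) :
    TendstoFine Z k fun α =>
      ∑ᶠ C ∈ {C : Set (EdgeSpace Z V j) | ∃ y, C = mAtom (cellAlg V hj α) y},
        (μ (α.tail j) C).toReal *
          ∫ z, ‖F (α.tail j) z -
              ∫ w, F (α.tail j) w ∂((μ (α.tail j))[|C])‖ ∂((μ (α.tail j))[|C]) := by
  intro ε hε
  have key : ∀ t : ColTail Z k j, ∃ B₀ : {B : MeasurableSpace (Z j) // IsColAlg B},
      ∀ B : MeasurableSpace (Z j), IsColAlg B → B₀.val ≤ B →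
        ∑ᶠ C ∈ {C : Set (EdgeSpace Z V j) | ∃ y, C =
            mAtom (@MeasurableSpace.pi (Fin j ↪ V) (fun _ => Z j) fun _ => B) y},
          (μ t C).toReal *
            ∫ z, ‖F t z - ∫ w, F t w ∂((μ t)[|C])‖ ∂((μ t)[|C]) ≤ ε := by
    intro t
    have := hμ t
    obtain ⟨c, hc⟩ := hFbdd t
    have hint : Integrable (F t) (μ t) :=
      Integrable.of_bound (hFmeas t).aestronglyMeasurable c (Filter.Eventually.of_forall hc)
    have : CompleteSpace (H t) := FiniteDimensional.complete ℝ (H t)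
    obtain ⟨B₀, hB₀, h⟩ :=
      @exists_isColAlg_finsum_mAtom_le (Fin j ↪ V) (Z j) _ _ (hZ j)
        (inferInstanceAs (MeasurableSpace (EdgeSpace Z V j)))
        (inferInstanceAs (BorelSpace (EdgeSpace Z V j))) (H t) _ _ _ (μ t) (hμ t) (F t) hint ε hε
    exact ⟨⟨B₀, hB₀⟩, h⟩
  choose B₀ hB₀ using key
  let i : Fin (k + 1) := ⟨j, Nat.lt_succ_of_le hj⟩
  have hU : {α : ColTuple Z k | (B₀ fun i' _ => α i').val ≤ (α i).val} ∈ colSubbasis Z k :=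
    ⟨i, fun β => B₀ fun i' hi' => β i' hi', rfl⟩
  refine ⟨_, TopologicalSpace.isOpen_generateFrom_of_mem hU, nonempty_colSubbasis hU,
    fun α hα => ?_⟩
  rw [abs_of_nonneg (finsum_nonneg fun C => finsum_nonneg fun _ => by positivity)]
  exact hB₀ (α.tail j) (α i).val (α i).property hα
end
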